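/- In the Yangian Y(sl₂), the ordered monomials e_0^{n_0}e_1^{n_1}···e_k^{n_k}·h_0^{m_0}h_1^{m_1}···h_p^{m_p}·f_0^{l_0}f_1^{l_1}···f_q^{l_q} (all exponents ≥ 0, finitely many nonzero) constitute a ℂ-vector space basis of Y(sl₂). -/

import Mathlib

noncomputable section

/-- Generators of the Yangian `Y(sl₂)`. -/
inductive G2 : Type
  | e : ℕ → G2
  | f : ℕ → G2
  | h : ℕ → G2

namespace Ysl2Def

abbrev FA : Type := FreeAlgebra ℂ G2

def E (k : ℕ) : FA := FreeAlgebra.ι ℂ (G2.e k)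
def F (k : ℕ) : FA := FreeAlgebra.ι ℂ (G2.f k)
def H (k : ℕ) : FA := FreeAlgebra.ι ℂ (G2.h k)

/-- The defining relations of the Yangian `Y(sl₂)` (Drinfeld's presentation). -/
inductive Rel : FA → FA → Prop
  | hh (k l : ℕ) : Rel (H k * H l) (H l * H k)
  | h0e (l : ℕ) : Rel (H 0 * E l - E l * H 0) (2 * E l)
  | h0f (l : ℕ) : Rel (H 0 * F l - F l * H 0) (-(2 * F l))
  | ef (k l : ℕ) : Rel (E k * F l - F l * E k) (H (k + l))
  | he (k l : ℕ) :
      Rel ((H (k + 1) * E l - E l * H (k + 1)) - (H k * E (l + 1) - E (l + 1) * H k))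
        (H k * E l + E l * H k)
  | hf (k l : ℕ) :
      Rel ((H (k + 1) * F l - F l * H (k + 1)) - (H k * F (l + 1) - F (l + 1) * H k))
        (-(H k * F l + F l * H k))
  | ee (k l : ℕ) :
      Rel ((E (k + 1) * E l - E l * E (k + 1)) - (E k * E (l + 1) - E (l + 1) * E k))
        (E k * E l + E l * E k)
  | ff (k l : ℕ) :
      Rel ((F (k + 1) * F l - F l * F (k + 1)) - (F k * F (l + 1) - F (l + 1) * F k))
        (-(F k * F l + F l * F k))

end Ysl2Def

/-- The Yangian `Y(sl₂)`. -/
abbrev Ysl2 : Type := RingQuot Ysl2Def.Rel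

def eY (k : ℕ) : Ysl2 := RingQuot.mkAlgHom ℂ Ysl2Def.Rel (Ysl2Def.E k)
def fY (k : ℕ) : Ysl2 := RingQuot.mkAlgHom ℂ Ysl2Def.Rel (Ysl2Def.F k)
def hY (k : ℕ) : Ysl2 := RingQuot.mkAlgHom ℂ Ysl2Def.Rel (Ysl2Def.H k)

/-- The ordered product `x 0 ^ n 0 * x 1 ^ n 1 * ⋯` (indices in increasing order),
for a finitely supported exponent vector `n`. -/
def listProd (x : ℕ → Ysl2) (n : ℕ →₀ ℕ) : Ysl2 :=
  ((List.range (n.support.sup id + 1)).map fun k => x k ^ n k).prod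

/-- The ordered monomial `e₀^{n₀}⋯e_k^{n_k} · h₀^{m₀}⋯h_p^{m_p} · f₀^{l₀}⋯f_q^{l_q}`
attached to a triple of exponent vectors. -/
def orderedMono (p : (ℕ →₀ ℕ) × (ℕ →₀ ℕ) × (ℕ →₀ ℕ)) : Ysl2 :=
  listProd eY p.1 * listProd hY p.2.1 * listProd fY p.2.2

namespace Ysl2

open Ysl2Def

/-- The image of a generator in the Yangian. -/
def gen : G2 → Ysl2
  | .e k => eY k
  | .f k => fY k
  | .h k => hY k

/-- The filtration degree of a generator. -/
def deg : G2 → ℕ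
  | .e k => k + 1
  | .f k => k + 1
  | .h k => k + 1

/-- The product in the Yangian of a word in the generators. -/
def word (w : List G2) : Ysl2 := (w.map gen).prod

/-- The filtration degree of a word. -/
def wordDeg (w : List G2) : ℕ := (w.map deg).sum

@[simp] lemma word_nil : word [] = 1 := rfl
@[simp] lemma wordDeg_nil : wordDeg [] = 0 := rfl
@[simp] lemma word_cons (g : G2) (w : List G2) : word (g :: w) = gen g * word w := by
  simp [word]
@[simp] lemma wordDeg_cons (g : G2) (w : List G2) : wordDeg (g :: w) = deg g + wordDeg w := by
  simp [wordDeg]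
lemma word_append (v w : List G2) : word (v ++ w) = word v * word w := by
  simp [word]
lemma wordDeg_append (v w : List G2) : wordDeg (v ++ w) = wordDeg v + wordDeg w := by
  simp [wordDeg]

/-- The span of the words of degree less than `d`. -/
def below (d : ℕ) : Submodule ℂ Ysl2 := Submodule.span ℂ {y | ∃ w, wordDeg w < d ∧ word w = y}

lemma word_mem_below {w : List G2} {d : ℕ} (h : wordDeg w < d) : word w ∈ below d :=
  Submodule.subset_span ⟨w, h, rfl⟩

lemma below_mono {a b : ℕ} (h : a ≤ b) : below a ≤ below b :=
  Submodule.span_mono fun _ ⟨w, hw, e⟩ => ⟨w, hw.trans_le h, e⟩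

lemma word_mul_mem_below (w : List G2) {d : ℕ} {y : Ysl2} (hy : y ∈ below d) :
    word w * y ∈ below (wordDeg w + d) := by
  induction hy using Submodule.span_induction with
  | mem y h =>
    obtain ⟨v, hv, rfl⟩ := h
    rw [← word_append]
    exact word_mem_below (by rw [wordDeg_append]; omega)
  | zero => simp
  | add x y _ _ hx hy => rw [mul_add]; exact add_mem hx hy
  | smul c x _ hx => rw [mul_smul_comm]; exact Submodule.smul_mem _ c hx

lemma mul_word_mem_below (w : List G2) {d : ℕ} {y : Ysl2} (hy : y ∈ below d) :
    y * word w ∈ below (d + wordDeg w) := by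
  induction hy using Submodule.span_induction with
  | mem y h =>
    obtain ⟨v, hv, rfl⟩ := h
    rw [← word_append]
    exact word_mem_below (by rw [wordDeg_append]; omega)
  | zero => simp
  | add x y _ _ hx hy => rw [add_mul]; exact add_mem hx hy
  | smul c x _ hx => rw [smul_mul_assoc]; exact Submodule.smul_mem _ c hx

lemma gen_mem_below {g : G2} {d : ℕ} (h : deg g < d) : gen g ∈ below d := by
  simpa using word_mem_below (w := [g]) (d := d) (by simpa using h)

lemma gen_mul_gen_mem_below {g g' : G2} {d : ℕ} (h : deg g + deg g' < d) :
    gen g * gen g' ∈ below d := by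
  simpa using word_mem_below (w := [g, g']) (d := d) (by simpa using h)

lemma rel_eq {a b : FA} (h : Rel a b) :
    RingQuot.mkAlgHom ℂ Rel a = RingQuot.mkAlgHom ℂ Rel b := RingQuot.mkAlgHom_rel ℂ h

lemma hh_eq (k l : ℕ) : hY k * hY l = hY l * hY k := by
  simpa [hY] using rel_eq (Rel.hh k l)
lemma h0e_eq (l : ℕ) : hY 0 * eY l - eY l * hY 0 = 2 * eY l := by
  simpa [hY, eY, two_mul] using rel_eq (Rel.h0e l)
lemma h0f_eq (l : ℕ) : hY 0 * fY l - fY l * hY 0 = -(2 * fY l) := by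
  simpa only [two_mul, map_mul, map_add, map_sub, map_neg] using! rel_eq (Rel.h0f l)
lemma ef_eq (k l : ℕ) : eY k * fY l - fY l * eY k = hY (k + l) := by
  simpa [hY, eY, fY] using rel_eq (Rel.ef k l)
lemma he_eq (k l : ℕ) :
    (hY (k + 1) * eY l - eY l * hY (k + 1)) - (hY k * eY (l + 1) - eY (l + 1) * hY k) =
      hY k * eY l + eY l * hY k := by
  simpa [hY, eY] using rel_eq (Rel.he k l)
lemma hf_eq (k l : ℕ) :
    (hY (k + 1) * fY l - fY l * hY (k + 1)) - (hY k * fY (l + 1) - fY (l + 1) * hY k) =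
      -(hY k * fY l + fY l * hY k) := by
  simpa only [map_mul, map_add, map_sub, map_neg] using! rel_eq (Rel.hf k l)
lemma ee_eq (k l : ℕ) :
    (eY (k + 1) * eY l - eY l * eY (k + 1)) - (eY k * eY (l + 1) - eY (l + 1) * eY k) =
      eY k * eY l + eY l * eY k := by
  simpa [eY] using rel_eq (Rel.ee k l)
lemma ff_eq (k l : ℕ) :
    (fY (k + 1) * fY l - fY l * fY (k + 1)) - (fY k * fY (l + 1) - fY (l + 1) * fY k) =
      -(fY k * fY l + fY l * fY k) := by
  simpa only [map_mul, map_add, map_sub, map_neg] using! rel_eq (Rel.ff k l)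

/-- The index of a commutator can be moved from one factor to the other modulo lower terms. -/
lemma comm_sub_comm_zero_mem {x y : ℕ → G2} (hx : ∀ k, deg (x k) = k + 1)
    (hy : ∀ k, deg (y k) = k + 1)
    (hrel : ∀ k l, (gen (x (k + 1)) * gen (y l) - gen (y l) * gen (x (k + 1))) -
        (gen (x k) * gen (y (l + 1)) - gen (y (l + 1)) * gen (x k)) =
          gen (x k) * gen (y l) + gen (y l) * gen (x k) ∨
      (gen (x (k + 1)) * gen (y l) - gen (y l) * gen (x (k + 1))) -
        (gen (x k) * gen (y (l + 1)) - gen (y (l + 1)) * gen (x k)) =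
          -(gen (x k) * gen (y l) + gen (y l) * gen (x k))) (k l : ℕ) :
    (gen (x k) * gen (y l) - gen (y l) * gen (x k)) -
      (gen (x 0) * gen (y (k + l)) - gen (y (k + l)) * gen (x 0)) ∈ below (k + l + 2) := by
  induction k generalizing l with
  | zero => simp
  | succ k ih =>
    have h1 := ih (l + 1)
    have h2 : gen (x k) * gen (y l) + gen (y l) * gen (x k) ∈ below (k + (l + 1) + 2) :=
      add_mem (gen_mul_gen_mem_below (by rw [hx, hy]; omega))
        (gen_mul_gen_mem_below (by rw [hx, hy]; omega))
    have h3 : (gen (x (k + 1)) * gen (y l) - gen (y l) * gen (x (k + 1))) -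
        (gen (x k) * gen (y (l + 1)) - gen (y (l + 1)) * gen (x k)) ∈
          below (k + (l + 1) + 2) := by
      rcases hrel k l with h | h <;> rw [h]
      · exact h2
      · exact neg_mem h2
    have h4 := add_mem h3 h1
    rw [show k + 1 + l = k + (l + 1) by omega]
    convert h4 using 1
    abel

/-- Generators of one family commute modulo lower terms. -/
lemma comm_self_mem {x : ℕ → G2} (hx : ∀ k, deg (x k) = k + 1)
    (hrel : ∀ k l, (gen (x (k + 1)) * gen (x l) - gen (x l) * gen (x (k + 1))) -
        (gen (x k) * gen (x (l + 1)) - gen (x (l + 1)) * gen (x k)) =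
          gen (x k) * gen (x l) + gen (x l) * gen (x k) ∨
      (gen (x (k + 1)) * gen (x l) - gen (x l) * gen (x (k + 1))) -
        (gen (x k) * gen (x (l + 1)) - gen (x (l + 1)) * gen (x k)) =
          -(gen (x k) * gen (x l) + gen (x l) * gen (x k))) (k l : ℕ) :
    gen (x k) * gen (x l) - gen (x l) * gen (x k) ∈ below (k + l + 2) := by
  have hmove := comm_sub_comm_zero_mem hx hx hrel
  have h0 : gen (x 0) * gen (x (k + l)) - gen (x (k + l)) * gen (x 0) ∈ below (k + l + 2) := by
    have h := Submodule.smul_mem _ (-(1 / 2) : ℂ) (hmove (k + l) 0)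
    rw [add_zero] at h
    convert h using 1
    module
  simpa using add_mem (hmove k l) h0

lemma comm_mem_of_comm_zero {x y : ℕ → G2} (hx : ∀ k, deg (x k) = k + 1)
    (hy : ∀ k, deg (y k) = k + 1)
    (hrel : ∀ k l, (gen (x (k + 1)) * gen (y l) - gen (y l) * gen (x (k + 1))) -
        (gen (x k) * gen (y (l + 1)) - gen (y (l + 1)) * gen (x k)) =
          gen (x k) * gen (y l) + gen (y l) * gen (x k) ∨
      (gen (x (k + 1)) * gen (y l) - gen (y l) * gen (x (k + 1))) -
        (gen (x k) * gen (y (l + 1)) - gen (y (l + 1)) * gen (x k)) =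
          -(gen (x k) * gen (y l) + gen (y l) * gen (x k)))
    (h0 : ∀ l, gen (x 0) * gen (y l) - gen (y l) * gen (x 0) ∈ below (l + 2)) (k l : ℕ) :
    gen (x k) * gen (y l) - gen (y l) * gen (x k) ∈ below (k + l + 2) := by
  simpa using add_mem (comm_sub_comm_zero_mem hx hy hrel k l) (h0 (k + l))

lemma comm_he_mem (k l : ℕ) : hY k * eY l - eY l * hY k ∈ below (k + l + 2) := by
  refine comm_mem_of_comm_zero (x := .h) (y := .e) (fun _ => rfl) (fun _ => rfl)
    (fun k l => .inl (he_eq k l)) (fun l => ?_) k l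
  have : (2 : Ysl2) * eY l = (2 : ℂ) • gen (.e l) := by rw [two_smul, two_mul]; rfl
  change hY 0 * eY l - eY l * hY 0 ∈ _
  rw [h0e_eq, this]
  exact Submodule.smul_mem _ _ (gen_mem_below (by simp [deg]))

lemma comm_hf_mem (k l : ℕ) : hY k * fY l - fY l * hY k ∈ below (k + l + 2) := by
  refine comm_mem_of_comm_zero (x := .h) (y := .f) (fun _ => rfl) (fun _ => rfl)
    (fun k l => .inr (hf_eq k l)) (fun l => ?_) k l
  have : -((2 : Ysl2) * fY l) = (-2 : ℂ) • gen (.f l) := by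
    rw [two_mul, show (-2 : ℂ) = -1 + -1 by norm_num, add_smul, neg_one_smul, neg_add]; rfl
  change hY 0 * fY l - fY l * hY 0 ∈ _
  rw [h0f_eq, this]
  exact Submodule.smul_mem _ _ (gen_mem_below (by simp [deg]))

lemma comm_ef_mem (k l : ℕ) : eY k * fY l - fY l * eY k ∈ below (k + l + 2) := by
  rw [ef_eq]
  exact gen_mem_below (g := .h (k + l)) (by simp [deg])

lemma comm_swap_mem {a b : Ysl2} {k l : ℕ} (h : a * b - b * a ∈ below (k + l + 2)) :
    b * a - a * b ∈ below (l + k + 2) := by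
  rw [add_comm l k, ← neg_sub]
  exact neg_mem h

/-- The associated graded algebra of the filtration by degree is commutative. -/
lemma comm_mem (g g' : G2) : gen g * gen g' - gen g' * gen g ∈ below (deg g + deg g') := by
  suffices ∀ k l, (deg g = k + 1) → (deg g' = l + 1) →
      gen g * gen g' - gen g' * gen g ∈ below (k + l + 2) by
    cases g <;> cases g' <;>
      exact below_mono (by simp only [deg]; omega) (this _ _ rfl rfl)
  rcases g with a | a | a <;> rcases g' with b | b | b <;> rintro _ _ ⟨⟩ ⟨⟩
  · exact comm_self_mem (x := .e) (fun _ => rfl) (fun k l => .inl (ee_eq k l)) _ _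
  · exact comm_ef_mem _ _
  · exact comm_swap_mem (comm_he_mem _ _)
  · exact comm_swap_mem (comm_ef_mem _ _)
  · exact comm_self_mem (x := .f) (fun _ => rfl) (fun k l => .inr (ff_eq k l)) _ _
  · exact comm_swap_mem (comm_hf_mem _ _)
  · exact comm_he_mem _ _
  · exact comm_hf_mem _ _
  · simp [gen, hh_eq a b]

lemma wordDeg_perm {v w : List G2} (h : v.Perm w) : wordDeg v = wordDeg w :=
  (h.map deg).sum_eq

lemma word_sub_word_mem_of_perm {v w : List G2} (h : v.Perm w) :
    word v - word w ∈ below (wordDeg v) := by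
  induction h with
  | nil => simp
  | @cons x v w _ ih =>
    simpa [mul_sub] using word_mul_mem_below [x] ih
  | swap x y l =>
    have := mul_word_mem_below l (comm_mem y x)
    simpa [sub_mul, mul_assoc, add_assoc] using this
  | trans h₁ _ ih₁ ih₂ =>
    rw [← wordDeg_perm h₁] at ih₂
    simpa using add_mem ih₁ ih₂

/-- The ordered word in one family of generators with given exponents. -/
def blockWord (x : ℕ → G2) (n : ℕ →₀ ℕ) : List G2 :=
  (List.range (n.support.sup id + 1)).flatMap fun k => List.replicate (n k) (x k)

/-- The ordered word attached to a triple of exponent vectors. -/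
def orderedWord (p : (ℕ →₀ ℕ) × (ℕ →₀ ℕ) × (ℕ →₀ ℕ)) : List G2 :=
  blockWord .e p.1 ++ blockWord .h p.2.1 ++ blockWord .f p.2.2

lemma word_blockWord (x : ℕ → G2) (n : ℕ →₀ ℕ) :
    word (blockWord x n) = listProd (fun k => gen (x k)) n := by
  unfold blockWord listProd
  induction List.range (n.support.sup id + 1) with
  | nil => simp
  | cons a l ih =>
    rw [List.flatMap_cons, word_append, ih, List.map_cons, List.prod_cons]
    simp [word]

lemma word_orderedWord (p : (ℕ →₀ ℕ) × (ℕ →₀ ℕ) × (ℕ →₀ ℕ)) :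
    word (orderedWord p) = orderedMono p := by
  simp only [orderedWord, word_append, word_blockWord]
  rfl

open Classical in
lemma count_blockWord {x : ℕ → G2} (hx : Function.Injective x) (n : ℕ →₀ ℕ) (k : ℕ) :
    (blockWord x n).count (x k) = n k := by
  have key : ∀ N, ((List.range N).flatMap fun k => List.replicate (n k) (x k)).count (x k) =
      if k < N then n k else 0 := by
    intro N
    induction N with
    | zero => simp
    | succ N ih =>
      rw [List.range_succ, List.flatMap_append, List.count_append, ih]
      simp only [List.flatMap_cons, List.flatMap_nil, List.append_nil, List.count_replicate,
        beq_iff_eq, hx.eq_iff]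
      split_ifs <;> first | omega | (subst_vars; omega)
  rw [blockWord, key]
  split_ifs with h
  · rfl
  · by_contra h0
    have : k ≤ n.support.sup id :=
      Finset.le_sup (f := id) (Finsupp.mem_support_iff.2 fun h => h0 h.symm)
    omega

open Classical in
lemma count_blockWord_of_ne {x : ℕ → G2} (n : ℕ →₀ ℕ) {g : G2} (hg : ∀ k, x k ≠ g) :
    (blockWord x n).count g = 0 := by
  refine List.count_eq_zero.2 fun h => ?_
  obtain ⟨k, -, hk⟩ := List.mem_flatMap.1 h
  exact hg k (List.eq_of_mem_replicate hk).symm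

open Classical in
/-- The exponents with which a family of generators occurs in a word. -/
def exponents (x : ℕ → G2) (hx : Function.Injective x) (w : List G2) : ℕ →₀ ℕ :=
  Finsupp.onFinset (w.toFinset.preimage x hx.injOn) (fun k => w.count (x k)) fun k hk => by
    simpa using List.count_pos_iff.1 (Nat.pos_of_ne_zero hk)

lemma exists_orderedWord_perm (w : List G2) : ∃ p, w.Perm (orderedWord p) := by
  classical
  have he : Function.Injective G2.e := fun _ _ => G2.e.inj
  have hf : Function.Injective G2.f := fun _ _ => G2.f.inj
  have hh : Function.Injective G2.h := fun _ _ => G2.h.inj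
  refine ⟨(exponents .e he w, exponents .h hh w, exponents .f hf w),
    List.perm_iff_count.2 fun g => ?_⟩
  simp only [orderedWord, List.count_append]
  cases g with
  | e k =>
    rw [count_blockWord he, count_blockWord_of_ne _ (by simp), count_blockWord_of_ne _ (by simp)]
    simp [exponents]
  | f k =>
    rw [count_blockWord hf, count_blockWord_of_ne _ (by simp), count_blockWord_of_ne _ (by simp)]
    simp [exponents]
  | h k =>
    rw [count_blockWord hh, count_blockWord_of_ne _ (by simp), count_blockWord_of_ne _ (by simp)]
    simp [exponents]

lemma below_le_span (d : ℕ) : below d ≤ Submodule.span ℂ (Set.range orderedMono) := by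
  induction d with
  | zero => exact Submodule.span_le.2 fun _ ⟨w, hw, _⟩ => absurd hw (by omega)
  | succ d ih =>
    refine Submodule.span_le.2 ?_
    rintro _ ⟨w, hw, rfl⟩
    obtain ⟨p, hp⟩ := exists_orderedWord_perm w
    have h1 := ih (below_mono (by omega) (word_sub_word_mem_of_perm hp))
    have h2 : word (orderedWord p) ∈ Submodule.span ℂ (Set.range orderedMono) :=
      Submodule.subset_span ⟨p, (word_orderedWord p).symm⟩
    simpa using add_mem h1 h2

lemma mk_mem_span (a : FA) : RingQuot.mkAlgHom ℂ Rel a ∈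
    Submodule.span ℂ (Set.range orderedMono) := by
  have h : RingQuot.mkAlgHom ℂ Rel a ∈ Submodule.span ℂ (Set.range word) := by
    induction a using FreeAlgebra.induction with
    | grade0 r =>
      rw [AlgHom.commutes, Algebra.algebraMap_eq_smul_one]
      exact Submodule.smul_mem _ _ (Submodule.subset_span ⟨[], rfl⟩)
    | grade1 g =>
      refine Submodule.subset_span ⟨[g], ?_⟩
      cases g <;> simp [gen, eY, fY, hY, E, F, H]
    | mul a b ha hb =>
      have := Submodule.mul_mem_mul ha hb
      rw [Submodule.span_mul_span] at this
      rw [map_mul]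
      refine Submodule.span_mono ?_ this
      rintro _ ⟨_, ⟨v, rfl⟩, _, ⟨w, rfl⟩, rfl⟩
      exact ⟨v ++ w, word_append v w⟩
    | add a b ha hb => rw [map_add]; exact add_mem ha hb
  refine Submodule.span_le.2 ?_ h
  rintro _ ⟨w, rfl⟩
  exact below_le_span _ (word_mem_below (Nat.lt_succ_self _))

theorem span_orderedMono : Submodule.span ℂ (Set.range orderedMono) = ⊤ := by
  refine eq_top_iff.2 fun y _ => ?_
  obtain ⟨a, rfl⟩ := RingQuot.mkAlgHom_surjective ℂ Rel y
  exact mk_mem_span a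

open Finset

section PartialFractions

/-- The geometric series `∑ a ^ k z ^ k`. -/
def geom (a : ℂ) : PowerSeries ℂ := PowerSeries.mk fun k => a ^ k

lemma one_sub_mul_geom (a : ℂ) : (1 - PowerSeries.C a * PowerSeries.X) * geom a = 1 := by
  ext k
  rw [sub_mul, one_mul, mul_assoc, map_sub, PowerSeries.coeff_C_mul]
  cases k with
  | zero => simp [geom]
  | succ k => simp [geom, PowerSeries.coeff_succ_X_mul, PowerSeries.coeff_one, pow_succ']

variable {σ : Type*} [Fintype σ] [DecidableEq σ]

open Polynomial in
lemma sum_prod_one_sub [Nonempty σ] {v : σ → ℂ} (hv : Function.Injective v) :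
    ∑ s, C (∏ t ∈ univ.erase s, (v s - v t)⁻¹) * ∏ t ∈ univ.erase s, (1 - C (v t) * X) =
      (X : ℂ[X]) ^ (Fintype.card σ - 1) := by
  refine eq_of_infinite_eval_eq _ _ (Set.Infinite.mono (s := {z : ℂ | z ≠ 0}) ?_ ?_)
  · intro z (hz : z ≠ 0)
    have h := congrArg (eval z⁻¹) (Lagrange.sum_basis (s := univ) hv.injOn univ_nonempty)
    have h2 := congrArg (z ^ (Fintype.card σ - 1) * ·) h
    simp only [eval_finsetSum, eval_one, mul_one, mul_sum] at h2
    simp only [Set.mem_ofPred_eq, eval_finsetSum, eval_mul, eval_C, eval_prod, eval_sub, eval_one,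
      eval_X, eval_pow]
    rw [← h2]
    refine sum_congr rfl fun s _ => ?_
    rw [show Fintype.card σ - 1 = #(univ.erase s) by simp [card_erase_of_mem], ← prod_const,
      Lagrange.basis, eval_prod, ← prod_mul_distrib, ← prod_mul_distrib]
    refine prod_congr rfl fun t _ => ?_
    simp only [Lagrange.basisDivisor, eval_mul, eval_C, eval_sub, eval_X]
    field_simp
  · exact (Set.finite_singleton (0 : ℂ)).infinite_compl

/-- The Euler–Jacobi identity: weighted power sums are complete homogeneous symmetric functions. -/
lemma sum_pow_mul_weight [Nonempty σ] {v : σ → ℂ} (hv : Function.Injective v) (q : ℕ) :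
    ∑ s, v s ^ q * ∏ t ∈ univ.erase s, (v s - v t)⁻¹ =
      PowerSeries.coeff q (PowerSeries.X ^ (Fintype.card σ - 1) * ∏ s, geom (v s)) := by
  have h := congrArg (fun p : Polynomial ℂ => (p : PowerSeries ℂ) * ∏ s, geom (v s))
    (sum_prod_one_sub hv)
  simp only [Polynomial.coe_pow, Polynomial.coe_X] at h
  rw [← h, ← Polynomial.coeToPowerSeries.ringHom_apply, map_sum, sum_mul, map_sum]
  refine sum_congr rfl fun s _ => ?_
  have h1 : (∏ t ∈ univ.erase s, (1 - PowerSeries.C (v t) * PowerSeries.X)) * ∏ t, geom (v t) =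
      geom (v s) := by
    rw [← mul_prod_erase univ _ (mem_univ s), mul_left_comm, ← prod_mul_distrib]
    simp [one_sub_mul_geom]
  have h2 : Polynomial.coeToPowerSeries.ringHom
      (∏ t ∈ univ.erase s, (1 - Polynomial.C (v t) * Polynomial.X)) =
        ∏ t ∈ univ.erase s, (1 - PowerSeries.C (v t) * PowerSeries.X) := by
    rw [map_prod]
    simp
  rw [map_mul Polynomial.coeToPowerSeries.ringHom, h2, mul_assoc, h1,
    Polynomial.coeToPowerSeries.ringHom_apply, Polynomial.coe_C, PowerSeries.coeff_C_mul, mul_comm]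
  simp [geom]

/-- The polynomial `∑ c_j z ^ j` with `j ≤ N`, as a power series. -/
def revSeries (N : ℕ) (c : ℕ → ℂ) : PowerSeries ℂ :=
  ∑ j ∈ range (N + 1), PowerSeries.C (c j) * PowerSeries.X ^ j

/-- The value of the polynomial `∑ c_j u ^ (N - j)`. -/
def polyVal (N : ℕ) (c : ℕ → ℂ) (u : ℂ) : ℂ := ∑ j ∈ range (N + 1), c j * u ^ (N - j)

lemma sum_pow_mul_polyVal_mul_weight [Nonempty σ] {v : σ → ℂ} (hv : Function.Injective v)
    (c : ℕ → ℂ) (k : ℕ) :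
    ∑ s, v s ^ k * polyVal (Fintype.card σ) c (v s) * ∏ t ∈ univ.erase s, (v s - v t)⁻¹ =
      PowerSeries.coeff (k + 1) (revSeries (Fintype.card σ) c * ∏ s, geom (v s)) := by
  obtain ⟨N, hN⟩ : ∃ N, Fintype.card σ = N + 1 :=
    Nat.exists_eq_succ_of_ne_zero Fintype.card_ne_zero
  have hq := fun q => sum_pow_mul_weight hv q
  rw [hN] at hq ⊢
  have h1 : PowerSeries.coeff (k + 1) (revSeries (N + 1) c * ∏ s, geom (v s)) =
      PowerSeries.coeff (k + 1 + N)
        (revSeries (N + 1) c * (PowerSeries.X ^ N * ∏ s, geom (v s))) := by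
    rw [mul_left_comm, add_comm _ N, PowerSeries.coeff_X_pow_mul', if_pos (by omega),
      Nat.add_sub_cancel_left]
  rw [h1, revSeries, sum_mul, map_sum]
  simp only [polyVal, mul_sum, sum_mul]
  rw [sum_comm]
  refine sum_congr rfl fun j hj => ?_
  have hj' : j ≤ N + 1 := Nat.lt_succ_iff.1 (mem_range.1 hj)
  rw [mul_assoc, PowerSeries.coeff_C_mul, PowerSeries.coeff_X_pow_mul', if_pos (by omega)]
  rw [← Nat.add_sub_cancel (n := N) (m := 1), ← hq, mul_sum]
  refine sum_congr rfl fun s _ => ?_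
  rw [show k + 1 + (N + 1 - 1) - j = k + (N + 1 - j) by omega, pow_add]
  simp only [Nat.add_sub_cancel]
  ring

end PartialFractions

section Representation

set_option linter.unusedSectionVars false

variable {ι : Type*} [Fintype ι] [DecidableEq ι]

/-- The coordinate functions on the lattice. -/
def pos (X : ι → ℂ) (ħ : ℂ) (m : ι → ℤ) (i : ι) : ℂ := X i + ħ * m i

/-- The product of the inverse differences of one coordinate with the others. -/
def vand (X : ι → ℂ) (ħ : ℂ) (m : ι → ℤ) (i : ι) : ℂ :=
  ∏ j ∈ univ.erase i, (pos X ħ m i - pos X ħ m j)⁻¹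

/-- The generating series of the Cartan currents on the lattice. -/
def cartan (X : ι → ℂ) (ħ : ℂ) (c : ℕ → ℂ) (m : ι → ℤ) : PowerSeries ℂ :=
  revSeries (2 * Fintype.card ι) c * ∏ i, geom (pos X ħ m i) * geom (pos X ħ m i + ħ)

/-- The difference operators representing the raising generators. -/
def opE (X : ι → ℂ) (ħ : ℂ) (α : ι → ℂ) (k : ℕ) : Module.End ℂ ((ι → ℤ) → ℂ) where
  toFun φ m := ∑ i, α i * pos X ħ m i ^ k * vand X ħ m i * φ (m - Pi.single i 1)
  map_add' φ ψ := by ext m; simp [mul_add, sum_add_distrib]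
  map_smul' a φ := by ext m; simp [mul_sum, mul_left_comm]

/-- The difference operators representing the lowering generators. -/
def opF (X : ι → ℂ) (ħ : ℂ) (α : ι → ℂ) (c : ℕ → ℂ) (k : ℕ) :
    Module.End ℂ ((ι → ℤ) → ℂ) where
  toFun φ m := ∑ i, (α i)⁻¹ * (pos X ħ m i + ħ) ^ k *
    -polyVal (2 * Fintype.card ι) c (pos X ħ m i + ħ) * vand X ħ m i * φ (m + Pi.single i 1)
  map_add' φ ψ := by ext m; simp only [Pi.add_apply, mul_add, sum_add_distrib]
  map_smul' a φ := by
    ext m; simp only [Pi.smul_apply, smul_eq_mul, RingHom.id_apply, mul_sum, mul_left_comm a]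

/-- The multiplication operators representing the Cartan generators. -/
def opH (X : ι → ℂ) (ħ : ℂ) (c : ℕ → ℂ) (k : ℕ) : Module.End ℂ ((ι → ℤ) → ℂ) where
  toFun φ m := PowerSeries.coeff (k + 1) (cartan X ħ c m) * φ m
  map_add' φ ψ := by ext m; simp [mul_add]
  map_smul' a φ := by ext m; simp [mul_left_comm]

lemma opE_apply (X : ι → ℂ) (ħ : ℂ) (α : ι → ℂ) (k : ℕ) (φ : (ι → ℤ) → ℂ) (m : ι → ℤ) :
    opE X ħ α k φ m = ∑ i, α i * pos X ħ m i ^ k * vand X ħ m i * φ (m - Pi.single i 1) := rfl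

lemma opF_apply (X : ι → ℂ) (ħ : ℂ) (α : ι → ℂ) (c : ℕ → ℂ) (k : ℕ) (φ : (ι → ℤ) → ℂ)
    (m : ι → ℤ) :
    opF X ħ α c k φ m = ∑ i, (α i)⁻¹ * (pos X ħ m i + ħ) ^ k *
      -polyVal (2 * Fintype.card ι) c (pos X ħ m i + ħ) * vand X ħ m i *
        φ (m + Pi.single i 1) := rfl

lemma opH_apply (X : ι → ℂ) (ħ : ℂ) (c : ℕ → ℂ) (k : ℕ) (φ : (ι → ℤ) → ℂ) (m : ι → ℤ) :
    opH X ħ c k φ m = PowerSeries.coeff (k + 1) (cartan X ħ c m) * φ m := rfl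

/-- No two coordinates can be brought together by integral shifts. -/
def Generic (X : ι → ℂ) (ħ : ℂ) : Prop := ∀ i j, i ≠ j → ∀ s : ℤ, X i - X j + s * ħ ≠ 0

variable {X : ι → ℂ} {ħ : ℂ}

@[simp] lemma pos_sub_same (m : ι → ℤ) (i : ι) :
    pos X ħ (m - Pi.single i 1) i = pos X ħ m i - ħ := by
  simp [pos]; ring

@[simp] lemma pos_add_same (m : ι → ℤ) (i : ι) :
    pos X ħ (m + Pi.single i 1) i = pos X ħ m i + ħ := by
  simp [pos]; ring

lemma pos_sub_of_ne (m : ι → ℤ) {i j : ι} (h : i ≠ j) :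
    pos X ħ (m - Pi.single i 1) j = pos X ħ m j := by
  simp [pos, h.symm]

lemma pos_add_of_ne (m : ι → ℤ) {i j : ι} (h : i ≠ j) :
    pos X ħ (m + Pi.single i 1) j = pos X ħ m j := by
  simp [pos, h.symm]

lemma Generic.pos_ne (hX : Generic X ħ) (m : ι → ℤ) {i j : ι} (h : i ≠ j) (s : ℤ) :
    pos X ħ m i - pos X ħ m j + s * ħ ≠ 0 := by
  convert hX i j h (m i - m j + s) using 1
  simp only [pos]
  push_cast
  ring

lemma vand_split (m : ι → ℤ) {i j : ι} (h : i ≠ j) :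
    vand X ħ m j = (pos X ħ m j - pos X ħ m i)⁻¹ *
      ∏ l ∈ (univ.erase j).erase i, (pos X ħ m j - pos X ħ m l)⁻¹ :=
  (mul_prod_erase _ _ (by simpa using h)).symm

lemma vand_sub_of_ne (hX : Generic X ħ) (m : ι → ℤ) {i j : ι} (h : i ≠ j) :
    vand X ħ (m - Pi.single i 1) j =
      vand X ħ m j * (pos X ħ m j - pos X ħ m i) / (pos X ħ m j - pos X ħ m i + ħ) := by
  have h0 := hX.pos_ne m h.symm 0
  have h1 := hX.pos_ne m h.symm 1
  rw [vand_split _ h, vand_split _ h, pos_sub_same, pos_sub_of_ne m h]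
  have : ∏ l ∈ (univ.erase j).erase i, (pos X ħ m j - pos X ħ (m - Pi.single i 1) l)⁻¹ =
      ∏ l ∈ (univ.erase j).erase i, (pos X ħ m j - pos X ħ m l)⁻¹ :=
    prod_congr rfl fun l hl => by rw [pos_sub_of_ne m (mem_erase.1 hl).1.symm]
  rw [this]
  simp only [Int.cast_zero, zero_mul, add_zero, Int.cast_one, one_mul] at h0 h1
  rw [show pos X ħ m j - (pos X ħ m i - ħ) = pos X ħ m j - pos X ħ m i + ħ by ring]
  field_simp

lemma vand_add_of_ne (hX : Generic X ħ) (m : ι → ℤ) {i j : ι} (h : i ≠ j) :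
    vand X ħ (m + Pi.single i 1) j =
      vand X ħ m j * (pos X ħ m j - pos X ħ m i) / (pos X ħ m j - pos X ħ m i - ħ) := by
  have h0 := hX.pos_ne m h.symm 0
  have h1 := hX.pos_ne m h.symm (-1)
  rw [vand_split _ h, vand_split _ h, pos_add_same, pos_add_of_ne m h]
  have : ∏ l ∈ (univ.erase j).erase i, (pos X ħ m j - pos X ħ (m + Pi.single i 1) l)⁻¹ =
      ∏ l ∈ (univ.erase j).erase i, (pos X ħ m j - pos X ħ m l)⁻¹ :=
    prod_congr rfl fun l hl => by rw [pos_add_of_ne m (mem_erase.1 hl).1.symm]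
  rw [this]
  simp only [Int.cast_zero, zero_mul, add_zero, Int.cast_neg, Int.cast_one, neg_mul, one_mul,
    ← sub_eq_add_neg] at h0 h1
  rw [show pos X ħ m j - (pos X ħ m i + ħ) = pos X ħ m j - pos X ħ m i - ħ by ring]
  field_simp

lemma opE_mul_opE_apply (α : ι → ℂ) (k l : ℕ) (φ : (ι → ℤ) → ℂ) (m : ι → ℤ) :
    (opE X ħ α k * opE X ħ α l) φ m = ∑ i, ∑ j, α i * pos X ħ m i ^ k * vand X ħ m i *
      (α j * pos X ħ (m - Pi.single i 1) j ^ l * vand X ħ (m - Pi.single i 1) j *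
        φ (m - Pi.single i 1 - Pi.single j 1)) := by
  simp only [Module.End.mul_apply, opE_apply, mul_sum]

lemma opE_rel (hX : Generic X ħ) (α : ι → ℂ) (k l : ℕ) :
    (opE X ħ α (k + 1) * opE X ħ α l - opE X ħ α l * opE X ħ α (k + 1)) -
      (opE X ħ α k * opE X ħ α (l + 1) - opE X ħ α (l + 1) * opE X ħ α k) =
        ħ • (opE X ħ α k * opE X ħ α l + opE X ħ α l * opE X ħ α k) := by
  ext φ m
  simp only [LinearMap.sub_apply, LinearMap.add_apply, LinearMap.smul_apply, Pi.sub_apply,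
    Pi.add_apply, Pi.smul_apply, smul_eq_mul]
  rw [opE_mul_opE_apply α (k + 1) l, opE_mul_opE_apply α k (l + 1), opE_mul_opE_apply α k l,
    opE_mul_opE_apply α l, opE_mul_opE_apply α (l + 1), opE_mul_opE_apply α l,
    sum_comm (f := fun i j => α i * pos X ħ m i ^ l * _ * (α j * _ ^ (k + 1) * _ * _)),
    sum_comm (f := fun i j => α i * pos X ħ m i ^ (l + 1) * _ * (α j * _ ^ k * _ * _)),
    sum_comm (f := fun i j => α i * pos X ħ m i ^ l * _ * (α j * _ ^ k * _ * _))]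
  simp only [← sum_sub_distrib, ← sum_add_distrib, mul_sum]
  refine sum_congr rfl fun i _ => sum_congr rfl fun j _ => ?_
  rcases eq_or_ne i j with rfl | h
  · simp only [pos_sub_same]
    ring
  · have h1 := hX.pos_ne m h 1
    have h2 := hX.pos_ne m h.symm 1
    simp only [Int.cast_one, one_mul] at h1 h2
    rw [pos_sub_of_ne m h, pos_sub_of_ne m h.symm, vand_sub_of_ne hX m h,
      vand_sub_of_ne hX m h.symm, sub_right_comm m (Pi.single j 1)]
    field_simp
    ring

lemma opF_mul_opF_apply (α : ι → ℂ) (c : ℕ → ℂ) (k l : ℕ) (φ : (ι → ℤ) → ℂ) (m : ι → ℤ) :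
    (opF X ħ α c k * opF X ħ α c l) φ m = ∑ i, ∑ j, (α i)⁻¹ * (pos X ħ m i + ħ) ^ k *
      -polyVal (2 * Fintype.card ι) c (pos X ħ m i + ħ) * vand X ħ m i *
      ((α j)⁻¹ * (pos X ħ (m + Pi.single i 1) j + ħ) ^ l *
        -polyVal (2 * Fintype.card ι) c (pos X ħ (m + Pi.single i 1) j + ħ) *
        vand X ħ (m + Pi.single i 1) j * φ (m + Pi.single i 1 + Pi.single j 1)) := by
  simp only [Module.End.mul_apply, opF_apply, mul_sum]

lemma opF_rel (hX : Generic X ħ) (α : ι → ℂ) (c : ℕ → ℂ) (k l : ℕ) :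
    (opF X ħ α c (k + 1) * opF X ħ α c l - opF X ħ α c l * opF X ħ α c (k + 1)) -
      (opF X ħ α c k * opF X ħ α c (l + 1) - opF X ħ α c (l + 1) * opF X ħ α c k) =
        -(ħ • (opF X ħ α c k * opF X ħ α c l + opF X ħ α c l * opF X ħ α c k)) := by
  ext φ m
  simp only [LinearMap.sub_apply, LinearMap.add_apply, LinearMap.smul_apply, Pi.sub_apply,
    Pi.add_apply, Pi.smul_apply, smul_eq_mul, LinearMap.neg_apply, Pi.neg_apply]
  rw [opF_mul_opF_apply α c (k + 1) l, opF_mul_opF_apply α c k (l + 1),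
    opF_mul_opF_apply α c k l,
    opF_mul_opF_apply α c l, opF_mul_opF_apply α c (l + 1), opF_mul_opF_apply α c l,
    sum_comm (f := fun i j => (α i)⁻¹ * (pos X ħ m i + ħ) ^ l * _ * _ *
      ((α j)⁻¹ * _ ^ (k + 1) * _ * _ * _)),
    sum_comm (f := fun i j => (α i)⁻¹ * (pos X ħ m i + ħ) ^ (l + 1) * _ * _ *
      ((α j)⁻¹ * _ ^ k * _ * _ * _)),
    sum_comm (f := fun i j => (α i)⁻¹ * (pos X ħ m i + ħ) ^ l * _ * _ *
      ((α j)⁻¹ * _ ^ k * _ * _ * _))]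
  simp only [← sum_sub_distrib, ← sum_add_distrib, mul_sum, ← sum_neg_distrib]
  refine sum_congr rfl fun i _ => sum_congr rfl fun j _ => ?_
  rcases eq_or_ne i j with rfl | h
  · simp only [pos_add_same]
    ring
  · have h1 := hX.pos_ne m h (-1)
    have h2 := hX.pos_ne m h.symm (-1)
    simp only [Int.cast_neg, Int.cast_one, neg_mul, one_mul, ← sub_eq_add_neg] at h1 h2
    rw [pos_add_of_ne m h, pos_add_of_ne m h.symm, vand_add_of_ne hX m h,
      vand_add_of_ne hX m h.symm, add_right_comm m (Pi.single j 1)]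
    generalize (α i)⁻¹ = a, (α j)⁻¹ = b
    field_simp
    ring

lemma cartan_shift (c : ℕ → ℂ) (m : ι → ℤ) (i : ι) :
    (1 - PowerSeries.C (pos X ħ m i + ħ) * PowerSeries.X) * cartan X ħ c m =
      (1 - PowerSeries.C (pos X ħ m i - ħ) * PowerSeries.X) *
        cartan X ħ c (m - Pi.single i 1) := by
  have h1 := one_sub_mul_geom (pos X ħ m i + ħ)
  have h2 := one_sub_mul_geom (pos X ħ m i - ħ)
  have : ∏ j ∈ univ.erase i, geom (pos X ħ (m - Pi.single i 1) j) *
        geom (pos X ħ (m - Pi.single i 1) j + ħ) =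
      ∏ j ∈ univ.erase i, geom (pos X ħ m j) * geom (pos X ħ m j + ħ) :=
    prod_congr rfl fun j hj => by rw [pos_sub_of_ne m (mem_erase.1 hj).1.symm]
  simp only [cartan]
  rw [← mul_prod_erase univ _ (mem_univ i), ← mul_prod_erase univ _ (mem_univ i), this,
    pos_sub_same, sub_add_cancel]
  linear_combination (revSeries (2 * Fintype.card ι) c * geom (pos X ħ m i) *
    ∏ j ∈ univ.erase i, geom (pos X ħ m j) * geom (pos X ħ m j + ħ)) * (h1 - h2)

lemma coeff_cartan_shift (c : ℕ → ℂ) (m : ι → ℤ) (i : ι) (k : ℕ) :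
    PowerSeries.coeff (k + 1) (cartan X ħ c m) -
        (pos X ħ m i + ħ) * PowerSeries.coeff k (cartan X ħ c m) =
      PowerSeries.coeff (k + 1) (cartan X ħ c (m - Pi.single i 1)) -
        (pos X ħ m i - ħ) * PowerSeries.coeff k (cartan X ħ c (m - Pi.single i 1)) := by
  have h := congrArg (PowerSeries.coeff (k + 1)) (cartan_shift (X := X) (ħ := ħ) c m i)
  rw [sub_mul, sub_mul, one_mul, one_mul, mul_assoc, mul_assoc, map_sub, map_sub,
    PowerSeries.coeff_C_mul, PowerSeries.coeff_C_mul, PowerSeries.coeff_succ_X_mul,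
    PowerSeries.coeff_succ_X_mul] at h
  exact h

lemma coeff_zero_cartan {c : ℕ → ℂ} (hc : c 0 = 1) (m : ι → ℤ) :
    PowerSeries.coeff 0 (cartan X ħ c m) = 1 := by
  simp [cartan, revSeries, geom, sum_range_succ', hc]

lemma opH_mul_comm (c : ℕ → ℂ) (k l : ℕ) :
    opH X ħ c k * opH X ħ c l = opH X ħ c l * opH X ħ c k := by
  ext φ m
  simp only [Module.End.mul_apply, opH_apply]
  ring

lemma opH_mul_opE_apply (α : ι → ℂ) (c : ℕ → ℂ) (k l : ℕ) (φ : (ι → ℤ) → ℂ) (m : ι → ℤ) :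
    (opH X ħ c k * opE X ħ α l) φ m = ∑ i, PowerSeries.coeff (k + 1) (cartan X ħ c m) *
      (α i * pos X ħ m i ^ l * vand X ħ m i * φ (m - Pi.single i 1)) := by
  simp only [Module.End.mul_apply, opH_apply, opE_apply, mul_sum]

lemma opE_mul_opH_apply (α : ι → ℂ) (c : ℕ → ℂ) (k l : ℕ) (φ : (ι → ℤ) → ℂ) (m : ι → ℤ) :
    (opE X ħ α l * opH X ħ c k) φ m = ∑ i, α i * pos X ħ m i ^ l * vand X ħ m i *
      (PowerSeries.coeff (k + 1) (cartan X ħ c (m - Pi.single i 1)) *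
        φ (m - Pi.single i 1)) := by
  simp only [Module.End.mul_apply, opH_apply, opE_apply]

lemma opH_mul_opF_apply (α : ι → ℂ) (c : ℕ → ℂ) (k l : ℕ) (φ : (ι → ℤ) → ℂ) (m : ι → ℤ) :
    (opH X ħ c k * opF X ħ α c l) φ m = ∑ i, PowerSeries.coeff (k + 1) (cartan X ħ c m) *
      ((α i)⁻¹ * (pos X ħ m i + ħ) ^ l *
        -polyVal (2 * Fintype.card ι) c (pos X ħ m i + ħ) * vand X ħ m i *
        φ (m + Pi.single i 1)) := by
  simp only [Module.End.mul_apply, opH_apply, opF_apply, mul_sum]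

lemma opF_mul_opH_apply (α : ι → ℂ) (c : ℕ → ℂ) (k l : ℕ) (φ : (ι → ℤ) → ℂ) (m : ι → ℤ) :
    (opF X ħ α c l * opH X ħ c k) φ m = ∑ i, (α i)⁻¹ * (pos X ħ m i + ħ) ^ l *
      -polyVal (2 * Fintype.card ι) c (pos X ħ m i + ħ) * vand X ħ m i *
      (PowerSeries.coeff (k + 1) (cartan X ħ c (m + Pi.single i 1)) *
        φ (m + Pi.single i 1)) := by
  simp only [Module.End.mul_apply, opH_apply, opF_apply]

lemma opH_zero_opE {c : ℕ → ℂ} (hc : c 0 = 1) (α : ι → ℂ) (l : ℕ) :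
    opH X ħ c 0 * opE X ħ α l - opE X ħ α l * opH X ħ c 0 = (2 * ħ) • opE X ħ α l := by
  ext φ m
  simp only [LinearMap.sub_apply, LinearMap.smul_apply, Pi.sub_apply, Pi.smul_apply, smul_eq_mul]
  rw [opH_mul_opE_apply, opE_mul_opH_apply, opE_apply, mul_sum, ← sum_sub_distrib]
  refine sum_congr rfl fun i _ => ?_
  have h := coeff_cartan_shift (X := X) (ħ := ħ) c m i 0
  rw [coeff_zero_cartan hc, coeff_zero_cartan hc] at h
  linear_combination (α i * pos X ħ m i ^ l * vand X ħ m i * φ (m - Pi.single i 1)) * h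

lemma opH_zero_opF {c : ℕ → ℂ} (hc : c 0 = 1) (α : ι → ℂ) (l : ℕ) :
    opH X ħ c 0 * opF X ħ α c l - opF X ħ α c l * opH X ħ c 0 =
      -((2 * ħ) • opF X ħ α c l) := by
  ext φ m
  simp only [LinearMap.sub_apply, LinearMap.smul_apply, Pi.sub_apply, Pi.smul_apply, smul_eq_mul,
    LinearMap.neg_apply, Pi.neg_apply]
  rw [opH_mul_opF_apply, opF_mul_opH_apply, opF_apply, mul_sum, ← sum_sub_distrib,
    ← sum_neg_distrib]
  refine sum_congr rfl fun i _ => ?_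
  have h := coeff_cartan_shift (X := X) (ħ := ħ) c (m + Pi.single i 1) i 0
  rw [coeff_zero_cartan hc, coeff_zero_cartan hc, add_sub_cancel_right] at h
  linear_combination ((α i)⁻¹ * (pos X ħ m i + ħ) ^ l *
    polyVal (2 * Fintype.card ι) c (pos X ħ m i + ħ) * vand X ħ m i *
    φ (m + Pi.single i 1)) * h

lemma opH_opE_rel (α : ι → ℂ) (c : ℕ → ℂ) (k l : ℕ) :
    (opH X ħ c (k + 1) * opE X ħ α l - opE X ħ α l * opH X ħ c (k + 1)) -
      (opH X ħ c k * opE X ħ α (l + 1) - opE X ħ α (l + 1) * opH X ħ c k) =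
        ħ • (opH X ħ c k * opE X ħ α l + opE X ħ α l * opH X ħ c k) := by
  ext φ m
  simp only [LinearMap.sub_apply, LinearMap.add_apply, LinearMap.smul_apply, Pi.sub_apply,
    Pi.add_apply, Pi.smul_apply, smul_eq_mul]
  simp only [opH_mul_opE_apply, opE_mul_opH_apply, ← sum_sub_distrib, ← sum_add_distrib, mul_sum]
  refine sum_congr rfl fun i _ => ?_
  have h := coeff_cartan_shift (X := X) (ħ := ħ) c m i (k + 1)
  linear_combination (α i * pos X ħ m i ^ l * vand X ħ m i * φ (m - Pi.single i 1)) * h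

lemma opH_opF_rel (α : ι → ℂ) (c : ℕ → ℂ) (k l : ℕ) :
    (opH X ħ c (k + 1) * opF X ħ α c l - opF X ħ α c l * opH X ħ c (k + 1)) -
      (opH X ħ c k * opF X ħ α c (l + 1) - opF X ħ α c (l + 1) * opH X ħ c k) =
        -(ħ • (opH X ħ c k * opF X ħ α c l + opF X ħ α c l * opH X ħ c k)) := by
  ext φ m
  simp only [LinearMap.sub_apply, LinearMap.add_apply, LinearMap.smul_apply, Pi.sub_apply,
    Pi.add_apply, Pi.smul_apply, smul_eq_mul, LinearMap.neg_apply, Pi.neg_apply]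
  simp only [opH_mul_opF_apply, opF_mul_opH_apply, ← sum_sub_distrib, ← sum_add_distrib, mul_sum,
    ← sum_neg_distrib]
  refine sum_congr rfl fun i _ => ?_
  have h := coeff_cartan_shift (X := X) (ħ := ħ) c (m + Pi.single i 1) i (k + 1)
  rw [add_sub_cancel_right, pos_add_same] at h
  linear_combination ((α i)⁻¹ * (pos X ħ m i + ħ) ^ l *
    polyVal (2 * Fintype.card ι) c (pos X ħ m i + ħ) * vand X ħ m i *
    φ (m + Pi.single i 1)) * h

lemma weight_inl (m : ι → ℤ) (i : ι) :
    ∏ t ∈ univ.erase (Sum.inl i), (pos X ħ m i -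
      Sum.elim (pos X ħ m) (fun j => pos X ħ m j + ħ) t)⁻¹ =
        -(ħ⁻¹ * vand X ħ m i * vand X ħ (m - Pi.single i 1) i) := by
  have h : univ.erase (Sum.inl i : ι ⊕ ι) = (univ.erase i).disjSum univ := by
    ext (j | j) <;> simp
  rw [h, prod_disjSum]
  simp only [Sum.elim_inl, Sum.elim_inr]
  rw [← mul_prod_erase univ _ (mem_univ i)]
  have : vand X ħ (m - Pi.single i 1) i =
      ∏ j ∈ univ.erase i, (pos X ħ m i - (pos X ħ m j + ħ))⁻¹ :=
    prod_congr rfl fun j hj => by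
      rw [pos_sub_of_ne m (mem_erase.1 hj).1.symm, pos_sub_same, sub_sub, add_comm ħ]
  rw [this, sub_add_cancel_left, inv_neg, vand]
  ring

lemma weight_inr (m : ι → ℤ) (i : ι) :
    ∏ t ∈ univ.erase (Sum.inr i), (pos X ħ m i + ħ -
      Sum.elim (pos X ħ m) (fun j => pos X ħ m j + ħ) t)⁻¹ =
        ħ⁻¹ * vand X ħ m i * vand X ħ (m + Pi.single i 1) i := by
  have h : univ.erase (Sum.inr i : ι ⊕ ι) = univ.disjSum (univ.erase i) := by
    ext (j | j) <;> simp
  rw [h, prod_disjSum]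
  simp only [Sum.elim_inl, Sum.elim_inr, add_sub_add_right_eq_sub]
  rw [← mul_prod_erase univ _ (mem_univ i)]
  have : vand X ħ (m + Pi.single i 1) i =
      ∏ j ∈ univ.erase i, (pos X ħ m i + ħ - pos X ħ m j)⁻¹ :=
    prod_congr rfl fun j hj => by
      rw [pos_add_of_ne m (mem_erase.1 hj).1.symm, pos_add_same]
  rw [this, add_sub_cancel_left, vand]
  ring

/-- The partial fraction expansion of the Cartan currents. -/
lemma sum_residues [Nonempty ι] (hX : Generic X ħ) (hħ : ħ ≠ 0) (c : ℕ → ℂ) (m : ι → ℤ)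
    (k : ℕ) :
    ∑ i, (pos X ħ m i ^ k * -polyVal (2 * Fintype.card ι) c (pos X ħ m i) * vand X ħ m i *
        vand X ħ (m - Pi.single i 1) i -
      (pos X ħ m i + ħ) ^ k * -polyVal (2 * Fintype.card ι) c (pos X ħ m i + ħ) * vand X ħ m i *
        vand X ħ (m + Pi.single i 1) i) =
      ħ * PowerSeries.coeff (k + 1) (cartan X ħ c m) := by
  have hv : Function.Injective (Sum.elim (pos X ħ m) (fun j => pos X ħ m j + ħ)) := by
    rintro (i | i) (j | j) h <;> simp only [Sum.elim_inl, Sum.elim_inr] at h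
    · by_contra hij
      refine hX.pos_ne m (i := i) (j := j) (fun e => hij (e ▸ rfl)) 0 ?_
      simp [h]
    · rcases eq_or_ne i j with rfl | hij
      · simp [hħ] at h
      · refine absurd ?_ (hX.pos_ne m hij (-1))
        simp [h]
    · rcases eq_or_ne i j with rfl | hij
      · simp [hħ] at h
      · refine absurd ?_ (hX.pos_ne m hij 1)
        simp [← h]
    · by_contra hij
      refine hX.pos_ne m (i := i) (j := j) (fun e => hij (e ▸ rfl)) 0 ?_
      simp [add_right_cancel h]
  have h := sum_pow_mul_polyVal_mul_weight hv c k
  rw [Fintype.card_sum, ← two_mul, Fintype.sum_sum_type, Fintype.prod_sum_type,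
    ← prod_mul_distrib] at h
  simp only [Sum.elim_inl, Sum.elim_inr, weight_inl, weight_inr] at h
  rw [cartan, ← h, mul_add, mul_sum, mul_sum, ← sum_add_distrib]
  refine sum_congr rfl fun i _ => ?_
  field_simp
  ring

lemma opE_mul_opF_apply (α : ι → ℂ) (c : ℕ → ℂ) (k l : ℕ) (φ : (ι → ℤ) → ℂ) (m : ι → ℤ) :
    (opE X ħ α k * opF X ħ α c l) φ m = ∑ i, ∑ j, α i * pos X ħ m i ^ k * vand X ħ m i *
      ((α j)⁻¹ * (pos X ħ (m - Pi.single i 1) j + ħ) ^ l *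
        -polyVal (2 * Fintype.card ι) c (pos X ħ (m - Pi.single i 1) j + ħ) *
        vand X ħ (m - Pi.single i 1) j * φ (m - Pi.single i 1 + Pi.single j 1)) := by
  simp only [Module.End.mul_apply, opE_apply, opF_apply, mul_sum]

lemma opF_mul_opE_apply (α : ι → ℂ) (c : ℕ → ℂ) (k l : ℕ) (φ : (ι → ℤ) → ℂ) (m : ι → ℤ) :
    (opF X ħ α c l * opE X ħ α k) φ m = ∑ i, ∑ j, (α j)⁻¹ * (pos X ħ m j + ħ) ^ l *
      -polyVal (2 * Fintype.card ι) c (pos X ħ m j + ħ) * vand X ħ m j *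
      (α i * pos X ħ (m + Pi.single j 1) i ^ k * vand X ħ (m + Pi.single j 1) i *
        φ (m + Pi.single j 1 - Pi.single i 1)) := by
  rw [sum_comm]
  simp only [Module.End.mul_apply, opE_apply, opF_apply, mul_sum]

lemma opE_opF_rel [Nonempty ι] (hX : Generic X ħ) (hħ : ħ ≠ 0) {α : ι → ℂ}
    (hα : ∀ i, α i ≠ 0) (c : ℕ → ℂ) (k l : ℕ) :
    opE X ħ α k * opF X ħ α c l - opF X ħ α c l * opE X ħ α k =
      ħ • opH X ħ c (k + l) := by
  ext φ m
  simp only [LinearMap.sub_apply, LinearMap.smul_apply, Pi.sub_apply, Pi.smul_apply, smul_eq_mul]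
  rw [opH_apply, ← mul_assoc, ← sum_residues hX hħ, opE_mul_opF_apply, opF_mul_opE_apply,
    sum_mul, ← sum_sub_distrib]
  refine sum_congr rfl fun i _ => ?_
  rw [← sum_sub_distrib, sum_eq_single i]
  · have := hα i
    simp only [pos_sub_same, pos_add_same, sub_add_cancel, add_sub_cancel_right]
    generalize polyVal _ c (pos X ħ m i) = p, polyVal _ c (pos X ħ m i + ħ) = q
    field_simp
    ring_nf
  · intro j _ hj
    rw [pos_sub_of_ne m hj.symm, pos_add_of_ne m hj, vand_sub_of_ne hX m hj.symm,
      vand_add_of_ne hX m hj, sub_add_eq_add_sub]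
    have hq : (pos X ħ m i - pos X ħ m j) / (pos X ħ m i - pos X ħ m j - ħ) =
        (pos X ħ m j - pos X ħ m i) / (pos X ħ m j - pos X ħ m i + ħ) := by
      rw [← neg_div_neg_eq]
      congr 1 <;> ring
    rw [mul_div_assoc, mul_div_assoc, hq]
    ring_nf
  · simp

end Representation

section Homomorphism

variable {ι : Type*} [Fintype ι] [DecidableEq ι]

/-- The rescaled difference operators, which satisfy the relations of the Yangian. -/
def repGen (X : ι → ℂ) (ħ : ℂ) (α : ι → ℂ) (c : ℕ → ℂ) : G2 → Module.End ℂ ((ι → ℤ) → ℂ)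
  | .e k => ħ⁻¹ ^ (k + 1) • opE X ħ α k
  | .f k => ħ⁻¹ ^ (k + 1) • opF X ħ α c k
  | .h k => ħ⁻¹ ^ (k + 1) • opH X ħ c k

variable {X : ι → ℂ} {ħ : ℂ} {α : ι → ℂ} {c : ℕ → ℂ}

lemma lift_repGen_rel [Nonempty ι] (hX : Generic X ħ) (hħ : ħ ≠ 0) (hα : ∀ i, α i ≠ 0)
    (hc : c 0 = 1) {a b : FA} (h : Rel a b) :
    FreeAlgebra.lift ℂ (repGen X ħ α c) a = FreeAlgebra.lift ℂ (repGen X ħ α c) b := by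
  obtain ⟨u, rfl⟩ : ∃ u : ℂ, ħ = u⁻¹ := ⟨ħ⁻¹, (inv_inv ħ).symm⟩
  have hu : u ≠ 0 := fun h => hħ (by simp [h])
  cases h with
  | hh k l =>
    simp only [H, map_mul, FreeAlgebra.lift_ι_apply, repGen, smul_mul_smul_comm, inv_inv]
    rw [opH_mul_comm, mul_comm]
  | h0e l =>
    simp only [E, H, map_mul, map_sub, map_add, two_mul, FreeAlgebra.lift_ι_apply,
      repGen, smul_mul_smul_comm, inv_inv]
    linear_combination (norm := skip) u ^ (l + 2) • opH_zero_opE (X := X) (ħ := u⁻¹) hc α l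
    match_scalars <;> field_simp <;> ring_nf
  | h0f l =>
    simp only [F, H, map_mul, map_sub, map_add, map_neg, two_mul, FreeAlgebra.lift_ι_apply,
      repGen, smul_mul_smul_comm, inv_inv]
    linear_combination (norm := skip) u ^ (l + 2) • opH_zero_opF (X := X) (ħ := u⁻¹) hc α l
    match_scalars <;> field_simp <;> ring_nf
  | ef k l =>
    simp only [E, F, H, map_mul, map_sub, FreeAlgebra.lift_ι_apply,
      repGen, smul_mul_smul_comm, inv_inv]
    linear_combination (norm := skip) u ^ (k + l + 2) • opE_opF_rel hX hħ hα c k l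
    match_scalars <;> field_simp <;> ring_nf
  | he k l =>
    simp only [E, H, map_mul, map_sub, map_add, FreeAlgebra.lift_ι_apply,
      repGen, smul_mul_smul_comm, inv_inv]
    linear_combination (norm := skip) u ^ (k + l + 3) • opH_opE_rel (X := X) (ħ := u⁻¹) α c k l
    match_scalars <;> field_simp <;> ring_nf
  | hf k l =>
    simp only [F, H, map_mul, map_sub, map_add, map_neg, FreeAlgebra.lift_ι_apply,
      repGen, smul_mul_smul_comm, inv_inv]
    linear_combination (norm := skip) u ^ (k + l + 3) • opH_opF_rel (X := X) (ħ := u⁻¹) α c k l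
    match_scalars <;> field_simp <;> ring_nf
  | ee k l =>
    simp only [E, map_mul, map_sub, map_add, FreeAlgebra.lift_ι_apply,
      repGen, smul_mul_smul_comm, inv_inv]
    linear_combination (norm := skip) u ^ (k + l + 3) • opE_rel hX α k l
    match_scalars <;> field_simp <;> ring_nf
  | ff k l =>
    simp only [F, map_mul, map_sub, map_add, map_neg, FreeAlgebra.lift_ι_apply,
      repGen, smul_mul_smul_comm, inv_inv]
    linear_combination (norm := skip) u ^ (k + l + 3) • opF_rel hX α c k l
    match_scalars <;> field_simp <;> ring_nf

lemma exists_algHom [Nonempty ι] (hX : Generic X ħ) (hħ : ħ ≠ 0) (hα : ∀ i, α i ≠ 0)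
    (hc : c 0 = 1) :
    ∃ ρ : Ysl2 →ₐ[ℂ] Module.End ℂ ((ι → ℤ) → ℂ), ∀ g, ρ (gen g) = repGen X ħ α c g := by
  refine ⟨RingQuot.liftAlgHom ℂ ⟨FreeAlgebra.lift ℂ (repGen X ħ α c),
    fun _ _ h => lift_repGen_rel hX hħ hα hc h⟩, ?_⟩
  rintro (k | k | k) <;> simp [gen, eY, fY, hY, E, F, H]

end Homomorphism

open Filter Topology

section Limits

set_option linter.unusedSectionVars false

variable {ι : Type*} [Fintype ι] [DecidableEq ι]

/-- A sequence of operators tends to a scalar, tested on sequences of functions which converge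
pointwise to a constant. -/
def ScalarLimit {I : Type*} (T : ℕ → Module.End ℂ (I → ℂ)) (a : ℂ) : Prop :=
  ∀ (φ : ℕ → I → ℂ) (b : ℂ), (∀ m, Tendsto (fun t => φ t m) atTop (𝓝 b)) →
    ∀ m, Tendsto (fun t => T t (φ t) m) atTop (𝓝 (a * b))

lemma ScalarLimit.listProd {I A : Type*} {T : ℕ → A → Module.End ℂ (I → ℂ)} {x : A → ℂ}
    (w : List A) (h : ∀ g ∈ w, ScalarLimit (fun t => T t g) (x g)) :
    ScalarLimit (fun t => (w.map (T t)).prod) (w.map x).prod := by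
  induction w with
  | nil =>
    intro φ b hφ m
    simpa using hφ m
  | cons g w ih =>
    intro φ b hφ m
    have h1 := ih (fun g hg => h g (List.mem_cons_of_mem _ hg)) φ b hφ
    simpa [mul_assoc] using h g List.mem_cons_self _ _ h1 m

variable {X : ι → ℂ} {ħ : ℕ → ℂ}

lemma tendsto_pos (hħ : Tendsto ħ atTop (𝓝 0)) (m : ι → ℤ) (i : ι) :
    Tendsto (fun t => pos X (ħ t) m i) atTop (𝓝 (X i)) := by
  simpa [pos] using (hħ.mul_const (m i : ℂ)).const_add (X i)

lemma tendsto_vand (hX : Function.Injective X) (hħ : Tendsto ħ atTop (𝓝 0)) (m : ι → ℤ) (i : ι) :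
    Tendsto (fun t => vand X (ħ t) m i) atTop (𝓝 (∏ j ∈ univ.erase i, (X i - X j)⁻¹)) :=
  tendsto_finsetProd _ fun j hj => ((tendsto_pos hħ m i).sub (tendsto_pos hħ m j)).inv₀
    (sub_ne_zero.2 fun h => (mem_erase.1 hj).1 (hX h).symm)

open scoped PowerSeries.WithPiTopology in
lemma tendsto_coeff_cartan (hħ : Tendsto ħ atTop (𝓝 0)) (c : ℕ → ℂ) (m : ι → ℤ) (k : ℕ) :
    Tendsto (fun t => PowerSeries.coeff k (cartan X (ħ t) c m)) atTop
      (𝓝 (PowerSeries.coeff k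
        (revSeries (2 * Fintype.card ι) c * ∏ i, geom (X i) * geom (X i)))) := by
  have hgeom {u : ℕ → ℂ} {a : ℂ} (hu : Tendsto u atTop (𝓝 a)) :
      Tendsto (fun t => geom (u t)) atTop (𝓝 (geom a)) := by
    refine (PowerSeries.WithPiTopology.tendsto_iff_coeff_tendsto ℂ _ _ _).2 fun k => ?_
    simpa [geom] using hu.pow k
  refine (PowerSeries.WithPiTopology.tendsto_iff_coeff_tendsto ℂ _ _ _).1 ?_ k
  refine Tendsto.const_mul _ (tendsto_finsetProd _ fun i _ => ?_)
  have h := tendsto_pos (X := X) hħ m i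
  exact (hgeom h).mul (hgeom (by simpa using h.add hħ))

lemma continuous_polyVal (N : ℕ) (c : ℕ → ℂ) : Continuous (polyVal N c) :=
  continuous_finsetSum _ fun _ _ => by fun_prop

lemma scalarLimit_opE (hX : Function.Injective X) (hħ : Tendsto ħ atTop (𝓝 0)) (α : ι → ℂ)
    (k : ℕ) :
    ScalarLimit (fun t => opE X (ħ t) α k)
      (∑ i, α i * X i ^ k * ∏ j ∈ univ.erase i, (X i - X j)⁻¹) := by
  intro φ b hφ m
  simp only [opE_apply, sum_mul]
  exact tendsto_finsetSum _ fun i _ => ((((tendsto_pos hħ m i).pow k).const_mul (α i)).mul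
    (tendsto_vand hX hħ m i)).mul (hφ _)

lemma scalarLimit_opF (hX : Function.Injective X) (hħ : Tendsto ħ atTop (𝓝 0)) (α : ι → ℂ)
    (c : ℕ → ℂ) (k : ℕ) :
    ScalarLimit (fun t => opF X (ħ t) α c k)
      (∑ i, (α i)⁻¹ * X i ^ k * -polyVal (2 * Fintype.card ι) c (X i) *
        ∏ j ∈ univ.erase i, (X i - X j)⁻¹) := by
  intro φ b hφ m
  simp only [opF_apply, sum_mul]
  refine tendsto_finsetSum _ fun i _ => ?_
  have h : Tendsto (fun t => pos X (ħ t) m i + ħ t) atTop (𝓝 (X i)) := by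
    simpa using (tendsto_pos (X := X) hħ m i).add hħ
  exact ((((h.pow k).const_mul (α i)⁻¹).mul
    (((continuous_polyVal _ c).tendsto _).comp h).neg).mul (tendsto_vand hX hħ m i)).mul (hφ _)

lemma scalarLimit_opH (hħ : Tendsto ħ atTop (𝓝 0)) (c : ℕ → ℂ) (k : ℕ) :
    ScalarLimit (fun t => opH X (ħ t) c k)
      (PowerSeries.coeff (k + 1)
        (revSeries (2 * Fintype.card ι) c * ∏ i, geom (X i) * geom (X i))) := by
  intro φ b hφ m
  simp only [opH_apply]
  exact (tendsto_coeff_cartan hħ c m (k + 1)).mul (hφ m)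

lemma coeff_revSeries (N : ℕ) (c : ℕ → ℂ) {k : ℕ} (hk : k ≤ N) :
    PowerSeries.coeff k (revSeries N c) = c k := by
  simp only [revSeries, map_sum, PowerSeries.coeff_C_mul, PowerSeries.coeff_X_pow]
  simp [Nat.lt_succ_iff.2 hk]

lemma exists_coefficients (hX : Function.Injective X) {S : PowerSeries ℂ}
    (hS : PowerSeries.coeff 0 S = 1) (y : ι → ℂ) :
    ∃ c : ℕ → ℂ, c 0 = 1 ∧ (∀ k ≤ Fintype.card ι, PowerSeries.coeff k
        (revSeries (2 * Fintype.card ι) c * ∏ i, geom (X i) * geom (X i)) =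
          PowerSeries.coeff k S) ∧
      ∀ i, polyVal (2 * Fintype.card ι) c (X i) = y i := by
  set n := Fintype.card ι with hn
  set G := ∏ i, geom (X i) * geom (X i) with hG
  set P := ∏ i, (1 - PowerSeries.C (X i) * PowerSeries.X) *
    (1 - PowerSeries.C (X i) * PowerSeries.X) with hP
  have hPG : P * G = 1 := by
    rw [hP, hG, ← prod_mul_distrib]
    refine prod_eq_one fun i _ => ?_
    rw [mul_mul_mul_comm, one_sub_mul_geom, one_mul]
  have hT0 : PowerSeries.coeff 0 (S * P) = 1 := by
    simp only [PowerSeries.coeff_zero_eq_constantCoeff] at hS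
    simp [hS, hP]
  set r : ι → ℂ := fun i =>
    y i - ∑ j ∈ range (n + 1), PowerSeries.coeff j (S * P) * X i ^ (2 * n - j) with hr
  set q := Lagrange.interpolate univ X r with hq
  have hqe (i : ι) : q.eval (X i) = r i :=
    Lagrange.eval_interpolate_at_node r hX.injOn (mem_univ i)
  have hqd : q.degree < (n : ℕ) := Lagrange.degree_interpolate_lt r hX.injOn
  refine ⟨fun j => if j ≤ n then PowerSeries.coeff j (S * P) else q.coeff (2 * n - j), ?_, ?_, ?_⟩
  · simpa using hT0
  · intro k hk
    trans PowerSeries.coeff k (S * P * G)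
    · rw [PowerSeries.coeff_mul, PowerSeries.coeff_mul]
      refine sum_congr rfl fun p hp => ?_
      have hp' : p.1 ≤ n :=
        (HasAntidiagonal.mem_antidiagonal.1 hp ▸ Nat.le_add_right _ _ : p.1 ≤ k).trans hk
      rw [coeff_revSeries _ _ (by omega), if_pos hp']
    · rw [mul_assoc, hPG, mul_one]
  · intro i
    have h1 : q.eval (X i) = ∑ j ∈ range n, q.coeff j * X i ^ j := by
      rcases eq_or_ne q 0 with h0 | h0
      · simp [h0]
      · exact Polynomial.eval_eq_sum_range' ((Polynomial.natDegree_lt_iff_degree_lt h0).2 hqd) _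
    rw [polyVal, show 2 * n + 1 = n + 1 + n by omega, sum_range_add]
    have h2 : ∑ j ∈ range (n + 1), (if j ≤ n then PowerSeries.coeff j (S * P)
        else q.coeff (2 * n - j)) * X i ^ (2 * n - j) =
          ∑ j ∈ range (n + 1), PowerSeries.coeff j (S * P) * X i ^ (2 * n - j) :=
      sum_congr rfl fun j hj => by rw [if_pos (Nat.lt_succ_iff.1 (mem_range.1 hj))]
    have h3 : ∑ j ∈ range n, (if n + 1 + j ≤ n then PowerSeries.coeff (n + 1 + j) (S * P)
        else q.coeff (2 * n - (n + 1 + j))) * X i ^ (2 * n - (n + 1 + j)) = r i := by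
      rw [← hqe, h1, ← sum_range_reflect]
      refine sum_congr rfl fun j hj => ?_
      have hj' := mem_range.1 hj
      rw [if_neg (by omega), show 2 * n - (n + 1 + (n - 1 - j)) = j by omega]
    rw [h2, h3, hr]
    ring

end Limits

/-- The base points `0, …, n - 1` of the lattice. -/
def base (n : ℕ) (i : Fin n) : ℂ := (i : ℕ)

lemma base_injective (n : ℕ) : Function.Injective (base n) :=
  fun _ _ h => Fin.ext (Nat.cast_injective h)

/-- A sequence of purely imaginary lattice spacings. -/
def spacing (t : ℕ) : ℂ := ((1 / (t + 1 : ℝ) : ℝ) : ℂ) * Complex.I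

lemma spacing_ne_zero (t : ℕ) : spacing t ≠ 0 :=
  mul_ne_zero (Complex.ofReal_ne_zero.2 (by positivity)) Complex.I_ne_zero

lemma tendsto_spacing : Tendsto spacing atTop (𝓝 0) := by
  have h := ((Complex.continuous_ofReal.tendsto 0).comp
    (tendsto_one_div_add_atTop_nhds_zero_nat (𝕜 := ℝ))).mul_const Complex.I
  rwa [Complex.ofReal_zero, zero_mul] at h

lemma generic_base (n t : ℕ) : Generic (base n) (spacing t) := by
  intro i j hij s h
  have h1 := congrArg Complex.re h
  simp only [base, spacing, Complex.add_re, Complex.sub_re, Complex.natCast_re, Complex.mul_re,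
    Complex.intCast_re, Complex.intCast_im, Complex.ofReal_re, Complex.ofReal_im, Complex.I_re,
    Complex.I_im, mul_zero, zero_mul, sub_zero, add_zero, Complex.zero_re, sub_eq_zero] at h1
  exact hij (Fin.ext (Nat.cast_injective h1))

/-- A point whose coordinates along one family are power sums with nonzero weights is a limit of
rescaled representations. -/
lemma exists_representations {n : ℕ} (hn : 0 < n) {a b : Fin n → ℂ} (ha : ∀ i, a i ≠ 0)
    {x : G2 → ℂ} (hxe : ∀ k < n, x (.e k) = ∑ i, a i * base n i ^ k)
    (hxf : ∀ k < n, x (.f k) = ∑ i, b i * base n i ^ k) :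
    ∃ ρ : ℕ → Ysl2 →ₐ[ℂ] Module.End ℂ ((Fin n → ℤ) → ℂ), ∀ g, deg g ≤ n →
      ScalarLimit (fun t => spacing t ^ deg g • ρ t (gen g)) (x g) := by
  have : Nonempty (Fin n) := ⟨⟨0, hn⟩⟩
  have hX := base_injective n
  set A : Fin n → ℂ := fun i => ∏ j ∈ univ.erase i, (base n i - base n j)⁻¹ with hAdef
  have hA (i : Fin n) : A i ≠ 0 := prod_ne_zero_iff.2 fun j hj =>
    inv_ne_zero (sub_ne_zero.2 fun h => (mem_erase.1 hj).1 (hX h).symm)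
  set α : Fin n → ℂ := fun i => a i / A i with hα
  obtain ⟨c, hc0, hch, hcf⟩ := exists_coefficients hX
    (S := PowerSeries.mk fun k => k.casesOn 1 fun k => x (.h k)) (by simp)
    (fun i => -(b i * α i / A i))
  choose ρ hρ using fun t => exists_algHom (c := c) (generic_base n t) (spacing_ne_zero t)
    (α := α) (fun i => div_ne_zero (ha i) (hA i)) hc0
  refine ⟨ρ, fun g hg => ?_⟩
  simp only [hρ]
  rcases g with k | k | k <;>
    simp only [deg, repGen, smul_smul, ← mul_pow, mul_inv_cancel₀ (spacing_ne_zero _), one_pow,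
      one_smul] at hg ⊢
  · convert scalarLimit_opE hX tendsto_spacing α k using 1
    rw [hxe k hg]
    refine sum_congr rfl fun i _ => ?_
    have := hA i
    change _ = a i / A i * _ * A i
    field_simp
  · convert scalarLimit_opF hX tendsto_spacing α c k using 1
    rw [hxf k hg]
    refine sum_congr rfl fun i _ => ?_
    rw [hcf]
    have := hA i
    have := ha i
    change _ = (a i / A i)⁻¹ * _ * -(-(b i * (a i / A i) / A i)) * A i
    field_simp
  · convert scalarLimit_opH (X := base n) tendsto_spacing c k using 1
    rw [hch (k + 1) (by simpa using hg)]
    simp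

lemma exists_weights (n : ℕ) (y : ℕ → ℂ) :
    ∃ a : Fin n → ℂ, ∀ k < n, y k = ∑ i, a i * base n i ^ k := by
  have hdet : IsUnit (Matrix.vandermonde (base n)).transpose := by
    rw [Matrix.isUnit_iff_isUnit_det, Matrix.det_transpose, isUnit_iff_ne_zero,
      Matrix.det_vandermonde_ne_zero_iff]
    exact base_injective n
  obtain ⟨a, ha⟩ := (Matrix.mulVec_surjective_iff_isUnit.2 hdet) fun k : Fin n => y k
  refine ⟨a, fun k hk => ?_⟩
  rw [← congrFun ha ⟨k, hk⟩]
  simp [Matrix.mulVec, dotProduct, Matrix.vandermonde_apply, mul_comm]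

variable {σ : Type*} {s : Finset σ} {c : σ → ℂ} {w : σ → List G2}

lemma sum_top_eq_zero_of_representations {D n : ℕ} (hD : ∀ p ∈ s, wordDeg (w p) ≤ D) (hDn : D ≤ n)
    (h : ∑ p ∈ s, c p • word (w p) = 0)
    {x : G2 → ℂ} {ρ : ℕ → Ysl2 →ₐ[ℂ] Module.End ℂ ((Fin n → ℤ) → ℂ)}
    (hρ : ∀ g, deg g ≤ n → ScalarLimit (fun t => spacing t ^ deg g • ρ t (gen g)) (x g)) :
    ∑ p ∈ s, c p * 0 ^ (D - wordDeg (w p)) * ((w p).map x).prod = 0 := by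
  have hword (t : ℕ) (v : List G2) :
      (v.map fun g => spacing t ^ deg g • ρ t (gen g)).prod =
        spacing t ^ wordDeg v • ρ t (word v) := by
    induction v with
    | nil => simp
    | cons g v ih =>
      rw [List.map_cons, List.prod_cons, ih, smul_mul_smul_comm, ← pow_add, ← map_mul, wordDeg_cons,
        word_cons]
  have hlim (p) (hp : p ∈ s) : Tendsto (fun t => c p * spacing t ^ (D - wordDeg (w p)) *
      ((w p).map fun g => spacing t ^ deg g • ρ t (gen g)).prod (fun _ => 1) 0) atTop
      (𝓝 (c p * 0 ^ (D - wordDeg (w p)) * ((w p).map x).prod)) := by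
    refine ((tendsto_spacing.pow _).const_mul _).mul ?_
    have hw : ∀ g ∈ w p, deg g ≤ n := fun g hg =>
      (List.single_le_sum (by simp) _ (List.mem_map_of_mem hg)).trans ((hD p hp).trans hDn)
    simpa using ScalarLimit.listProd (T := fun t g => spacing t ^ deg g • ρ t (gen g)) (w p)
      (fun g hg => hρ g (hw g hg)) (fun _ _ => 1) 1 (fun _ => tendsto_const_nhds) 0
  refine tendsto_nhds_unique (tendsto_finsetSum s hlim) ?_
  convert tendsto_const_nhds (x := (0 : ℂ)) using 2 with t
  have h1 : ρ t (∑ p ∈ s, c p • word (w p)) (fun _ => 1) 0 = 0 := by simp [h]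
  rw [map_sum, LinearMap.sum_apply, Finset.sum_apply] at h1
  rw [← mul_zero (spacing t ^ D), ← h1, mul_sum]
  refine sum_congr rfl fun p hp => ?_
  rw [hword, ← pow_sub_mul_pow (spacing t) (hD p hp)]
  simp
  ring

lemma sum_top_eq_zero {D : ℕ} (hD : ∀ p ∈ s, wordDeg (w p) ≤ D)
    (h : ∑ p ∈ s, c p • word (w p) = 0) (x : G2 → ℂ) :
    ∑ p ∈ s, c p * 0 ^ (D - wordDeg (w p)) * ((w p).map x).prod = 0 := by
  obtain ⟨a, ha⟩ := exists_weights (D + 1) fun k => x (.e k)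
  obtain ⟨b, hb⟩ := exists_weights (D + 1) fun k => x (.f k)
  let y (z : ℂ) : G2 → ℂ
    | .e k => x (.e k) + z * ∑ i, base (D + 1) i ^ k
    | g => x g
  have hy (g : G2) : Continuous fun z => y z g := by
    rcases g with k | k | k <;> dsimp only [y] <;> fun_prop
  have hy0 : y 0 = x := by
    ext (k | k | k) <;> simp [y]
  have hcont : Continuous fun z =>
      ∑ p ∈ s, c p * 0 ^ (D - wordDeg (w p)) * ((w p).map (y z)).prod :=
    continuous_finsetSum _ fun p _ => continuous_const.mul
      (continuous_list_prod (w p) fun g _ => hy g)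
  have hev : ∀ᶠ z in 𝓝[≠] (0 : ℂ), ∀ i, a i + z ≠ 0 := by
    refine eventually_all.2 fun i => ?_
    rcases eq_or_ne (a i) 0 with h0 | h0
    · filter_upwards [self_mem_nhdsWithin] with z hz
      simpa [h0] using hz
    · refine eventually_nhdsWithin_of_eventually_nhds ?_
      exact (by fun_prop : Continuous fun z => a i + z).continuousAt.eventually_ne (by simpa)
  have hlim := (hcont.tendsto 0).mono_left (nhdsWithin_le_nhds (s := {0}ᶜ))
  rw [hy0] at hlim
  refine tendsto_nhds_unique hlim (tendsto_const_nhds.congr' ?_)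
  filter_upwards [hev] with z hz
  obtain ⟨ρ, hρ⟩ := exists_representations D.succ_pos hz (x := y z) (b := b)
    (fun k hk => by simp [y, ha k hk, add_mul, sum_add_distrib, mul_sum]) hb
  exact (sum_top_eq_zero_of_representations hD D.le_succ h hρ).symm

/-- Words with distinct contents are linearly independent in the Yangian. -/
lemma linearIndependent_word (hw : Function.Injective fun p => (w p : Multiset G2)) :
    LinearIndependent ℂ fun p => word (w p) := by
  classical
  refine linearIndependent_iff'.2 fun s c h p hp => ?_
  by_contra hcp
  set s' := s.filter fun p => c p ≠ 0
  have h' : ∑ p ∈ s', c p • word (w p) = 0 := by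
    rw [← h]
    refine sum_subset (filter_subset _ _) fun q hq hq' => ?_
    rw [not_not.1 fun hc => hq' (mem_filter.2 ⟨hq, hc⟩), zero_smul]
  obtain ⟨q, hq, hmax⟩ := exists_max_image s' (fun p => wordDeg (w p))
    ⟨p, mem_filter.2 ⟨hp, hcp⟩⟩
  set D := wordDeg (w q)
  have hmono (v : List G2) : (v.map MvPolynomial.X).prod =
      MvPolynomial.monomial (Multiset.toFinsupp (v : Multiset G2)) (1 : ℂ) := by
    induction v with
    | nil => simp
    | cons g v ih =>
      rw [List.map_cons, List.prod_cons, ih, MvPolynomial.X, MvPolynomial.monomial_mul,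
        ← Multiset.cons_coe, ← Multiset.singleton_add, map_add, Multiset.toFinsupp_singleton,
        one_mul]
  have hQ : ∑ p ∈ s', MvPolynomial.C (c p * 0 ^ (D - wordDeg (w p))) *
      ((w p).map MvPolynomial.X).prod = (0 : MvPolynomial G2 ℂ) := by
    refine MvPolynomial.funext fun x => ?_
    have hx : MvPolynomial.eval x ∘ MvPolynomial.X = x := funext fun g => MvPolynomial.eval_X g
    simpa only [map_sum, map_mul, MvPolynomial.eval_C, map_list_prod, List.map_map, map_zero, hx]
      using sum_top_eq_zero hmax h' x
  have hcoeff := congrArg (MvPolynomial.coeff (Multiset.toFinsupp (w q : Multiset G2))) hQ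
  simp only [hmono, MvPolynomial.coeff_sum, MvPolynomial.coeff_C_mul, MvPolynomial.coeff_monomial,
    MvPolynomial.coeff_zero, EmbeddingLike.apply_eq_iff_eq] at hcoeff
  rw [sum_eq_single q (fun p _ hpq => by rw [if_neg (fun e => hpq (hw e)), mul_zero])
    (fun h => absurd hq h)] at hcoeff
  exact (mem_filter.1 hq).2 (by simpa [D] using hcoeff)

lemma orderedWord_injective :
    Function.Injective fun p => (orderedWord p : Multiset G2) := by
  classical
  rintro ⟨n, m, l⟩ ⟨n', m', l'⟩ h
  have he : Function.Injective G2.e := fun _ _ => G2.e.inj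
  have hf : Function.Injective G2.f := fun _ _ => G2.f.inj
  have hh : Function.Injective G2.h := fun _ _ => G2.h.inj
  have key (g : G2) := List.perm_iff_count.1 (Multiset.coe_eq_coe.1 h) g
  simp only [orderedWord, List.count_append] at key
  refine Prod.ext (Finsupp.ext fun k => ?_)
    (Prod.ext (Finsupp.ext fun k => ?_) (Finsupp.ext fun k => ?_))
  · simpa [count_blockWord he, count_blockWord_of_ne] using key (.e k)
  · simpa [count_blockWord hh, count_blockWord_of_ne] using key (.h k)
  · simpa [count_blockWord hf, count_blockWord_of_ne] using key (.f k)

theorem linearIndependent_orderedMono : LinearIndependent ℂ orderedMono := by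
  simpa only [word_orderedWord] using linearIndependent_word orderedWord_injective

end Ysl2

/-- PBW theorem for `Y(sl₂)`: the ordered monomials
`e₀^{n₀}⋯e_k^{n_k} h₀^{m₀}⋯h_p^{m_p} f₀^{l₀}⋯f_q^{l_q}` form a ℂ-vector space basis
of the Yangian `Y(sl₂)`. -/
theorem orderedMono_is_basis :
    LinearIndependent ℂ orderedMono ∧ Submodule.span ℂ (Set.range orderedMono) = ⊤ :=
  ⟨Ysl2.linearIndependent_orderedMono, Ysl2.span_orderedMono⟩
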